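/- Let A ⊆ S² be a Borel measurable set and let σ denote the uniform probability measure on S². Then the μ-measure of the set of directed lines that do not intersect A (i.e., neither the entry point X nor the exit point Y lies in A) equals (1 − σ(A))². -/

import Mathlib

open MeasureTheory Metric Real Filter
open scoped ENNReal RealInnerProductSpace Topology

noncomputable section

/-- Euclidean space `ℝⁿ`. -/
abbrev En (n : ℕ) := EuclideanSpace ℝ (Fin n)

/-- The unit sphere `S^{n-1} ⊂ ℝⁿ`. -/
def unitSphere (n : ℕ) : Set (En n) := Metric.sphere 0 1

/-- The uniform probability (normalized surface) measure on the unit sphere. -/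
def sigmaN (n : ℕ) : Measure (En n) :=
  (μH[(n : ℝ) - 1] (unitSphere n))⁻¹ •
    (μH[(n : ℝ) - 1] : Measure (En n)).restrict (unitSphere n)

/-- The open unit disc in the hyperplane orthogonal to `v`. -/
def disc (n : ℕ) (v : En n) : Set (En n) := {z | ⟪v, z⟫ = 0 ∧ ‖z‖ < 1}

/-- Normalized `(n-1)`-dimensional Hausdorff measure on the disc `{z ∈ v⊥ : ‖z‖ < 1}`. -/
def lambdaN (n : ℕ) (v : En n) : Measure (En n) :=
  (μH[(n : ℝ) - 1] (disc n v))⁻¹ •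
    (μH[(n : ℝ) - 1] : Measure (En n)).restrict (disc n v)

/-- The normalized kinematic measure on directed lines meeting the unit sphere,
parametrized by pairs `(v, z)` with `v` the direction and `z ∈ v⊥`, `‖z‖ < 1`. -/
def kinematic (n : ℕ) : Measure (En n × En n) :=
  (sigmaN n).bind (fun v => (Measure.dirac v).prod (lambdaN n v))

/-- The entry point of the line parametrized by `(v, z)` in the unit sphere. -/
def Xpt (n : ℕ) (p : En n × En n) : En n := p.2 - Real.sqrt (1 - ‖p.2‖ ^ 2) • p.1

/-- The exit point of the line parametrized by `(v, z)` in the unit sphere. -/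
def Ypt (n : ℕ) (p : En n × En n) : En n := p.2 + Real.sqrt (1 - ‖p.2‖ ^ 2) • p.1


instance continuousStar_clm : ContinuousStar (En 3 →L[ℝ] En 3) :=
  ⟨ContinuousLinearMap.adjoint.continuous⟩

instance compact_unitary : CompactSpace (unitary (En 3 →L[ℝ] En 3)) := by
  have : ProperSpace (En 3 →L[ℝ] En 3) := FiniteDimensional.proper ℝ _
  refine (isCompact_iff_compactSpace (s := (unitary (En 3 →L[ℝ] En 3) : Set (En 3 →L[ℝ] En 3)))).1 ?_
  refine Metric.isCompact_of_isClosed_isBounded isClosed_unitary ?_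
  rw [isBounded_iff_forall_norm_le]
  refine ⟨1, fun x hx => ?_⟩
  exact CStarRing.norm_of_mem_unitary hx |>.le

lemma exists_average (F : En 3 × En 3 → ℝ≥0∞) (hF : Measurable F) :
    ∃ Fb : En 3 × En 3 → ℝ≥0∞, Measurable Fb ∧
      (∀ (h : En 3 ≃ₗᵢ[ℝ] En 3) (x y : En 3), Fb (h x, h y) = Fb (x, y)) ∧
      ∀ ν : Measure (En 3 × En 3), SFinite ν →
        (∀ h : En 3 ≃ₗᵢ[ℝ] En 3, ∀ F : En 3 × En 3 → ℝ≥0∞, Measurable F →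
          ∫⁻ p, F (h p.1, h p.2) ∂ν = ∫⁻ p, F p ∂ν) →
        ∫⁻ p, F p ∂ν = ∫⁻ p, Fb p ∂ν := by
  have : ProperSpace (En 3 →L[ℝ] En 3) := FiniteDimensional.proper ℝ _
  let ρ : Measure (unitary (En 3 →L[ℝ] En 3)) :=
    (Measure.haarMeasure (⊤ : TopologicalSpace.PositiveCompacts _)).inv
  have hρ : IsProbabilityMeasure ρ := ⟨by
    have := Measure.haarMeasure_self (K₀ := (⊤ : TopologicalSpace.PositiveCompacts (unitary (En 3 →L[ℝ] En 3))))
    simpa [ρ, Measure.inv_apply] using this⟩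
  have hc : Continuous (fun q : (unitary (En 3 →L[ℝ] En 3)) × (En 3 × En 3) =>
      ((q.1 : En 3 →L[ℝ] En 3) q.2.1, (q.1 : En 3 →L[ℝ] En 3) q.2.2)) := by fun_prop
  have hm : Measurable (fun q : (unitary (En 3 →L[ℝ] En 3)) × (En 3 × En 3) =>
      F ((q.1 : En 3 →L[ℝ] En 3) q.2.1, (q.1 : En 3 →L[ℝ] En 3) q.2.2)) :=
    hF.comp hc.measurable
  refine ⟨fun p => ∫⁻ g, F ((g : En 3 →L[ℝ] En 3) p.1, (g : En 3 →L[ℝ] En 3) p.2) ∂ρ,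
    hm.lintegral_prod_left', ?_, ?_⟩
  · intro h x y
    have := lintegral_mul_right_eq_self (μ := ρ) (fun g : unitary (En 3 →L[ℝ] En 3) => 
      F ((g : En 3 →L[ℝ] En 3) x, (g : En 3 →L[ℝ] En 3) y)) (Unitary.linearIsometryEquiv.symm h)
    simpa using this
  · intro ν hν hinv
    rw [lintegral_lintegral_swap (f := fun (p : En 3 × En 3) (g : unitary (En 3 →L[ℝ] En 3)) => F ((g : En 3 →L[ℝ] En 3) p.1, (g : En 3 →L[ℝ] En 3) p.2))]
    · have : ∀ g : unitary (En 3 →L[ℝ] En 3), ∫⁻ p, F ((g : En 3 →L[ℝ] En 3) p.1, (g : En 3 →L[ℝ] En 3) p.2) ∂ν = ∫⁻ p, F p ∂ν := by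
        intro g
        exact hinv (Unitary.linearIsometryEquiv g) F hF
      simp [this]
    · exact (hm.comp measurable_swap).aemeasurable

lemma exists_iso_pair {E : Type*} [NormedAddCommGroup E] [InnerProductSpace ℝ E] [CompleteSpace E] (x y x' y' : E) (hx : ‖x‖ = ‖x'‖) (hy : ‖y‖ = ‖y'‖)
    (hxy : ⟪x, y⟫ = ⟪x', y'⟫) : ∃ h : E ≃ₗᵢ[ℝ] E, h x = x' ∧ h y = y' := by
  let r1 : E ≃ₗᵢ[ℝ] E := Submodule.reflection (ℝ ∙ (x - x'))ᗮ
  have h1 : r1 x = x' := Submodule.reflection_sub hx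
  have h2 : ‖r1 y‖ = ‖y'‖ := by rw [r1.norm_map, hy]
  have h3 : ⟪x', r1 y⟫ = ⟪x', y'⟫ := by
    rw [← hxy, ← r1.inner_map_map x y, h1]
  let r2 : E ≃ₗᵢ[ℝ] E := Submodule.reflection (ℝ ∙ (r1 y - y'))ᗮ
  refine ⟨r1.trans r2, ?_, ?_⟩
  · simp only [LinearIsometryEquiv.trans_apply, h1]
    apply Submodule.reflection_mem_subspace_eq_self
    rw [Submodule.mem_orthogonal_singleton_iff_inner_left, inner_sub_right, h3, sub_self]
  · exact Submodule.reflection_sub h2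

/-- A unit pair with prescribed inner product. -/
def pairOf (t : ℝ) : En 3 × En 3 := (!₂[1, 0, 0], !₂[t, √(1 - t ^ 2), 0])

lemma measurable_pairOf : Measurable pairOf := by
  unfold pairOf
  have : Continuous (fun t : ℝ => (!₂[t, √(1 - t ^ 2), 0] : En 3)) := by
    apply (PiLp.continuous_toLp 2 _).comp
    refine continuous_pi fun i => ?_
    fin_cases i <;> simp <;> fun_prop
  exact measurable_const.prodMk this.measurable

lemma exists_profile (F : En 3 × En 3 → ℝ≥0∞) (hF : Measurable F) :
    ∃ Φ : ℝ → ℝ≥0∞, Measurable Φ ∧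
      ∀ ν : Measure (En 3 × En 3), SFinite ν →
        (∀ h : En 3 ≃ₗᵢ[ℝ] En 3, ∀ F : En 3 × En 3 → ℝ≥0∞, Measurable F →
          ∫⁻ p, F (h p.1, h p.2) ∂ν = ∫⁻ p, F p ∂ν) →
        (∀ᵐ p ∂ν, ‖p.1‖ = 1 ∧ ‖p.2‖ = 1) →
        ∫⁻ p, F p ∂ν = ∫⁻ p, Φ ⟪p.1, p.2⟫ ∂ν := by
  obtain ⟨Fb, h1, h2, h3⟩ := exists_average F hF
  refine ⟨fun t => Fb (pairOf t), h1.comp measurable_pairOf, fun ν hν hi hs => ?_⟩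
  rw [h3 ν hν hi]
  apply lintegral_congr_ae
  filter_upwards [hs] with p hp
  obtain ⟨x, y⟩ := p
  obtain ⟨hx, hy⟩ := hp
  simp only at hx hy ⊢
  have ht := abs_real_inner_le_norm x y
  rw [hx, hy, one_mul, ← sq_le_one_iff_abs_le_one] at ht
  obtain ⟨h, ha, hb⟩ := exists_iso_pair x y (pairOf ⟪x, y⟫).1 (pairOf ⟪x, y⟫).2
    (by rw [hx]; simp [pairOf, EuclideanSpace.norm_eq, Fin.sum_univ_three])
    (by
      rw [hy, EuclideanSpace.norm_eq, Fin.sum_univ_three]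
      simp [pairOf, Real.sq_sqrt (sub_nonneg.2 ht)])
    (by simp [pairOf, PiLp.inner_apply, Fin.sum_univ_three])
  rw [← h2 h x y, ha, hb]

lemma exp_eq : (((3 : ℕ) : ℝ) - 1) = 2 := by norm_num

lemma finrank_orth (v : En 3) (hv : ‖v‖ = 1) : Module.finrank ℝ ((ℝ ∙ v)ᗮ : Submodule ℝ (En 3)) = 2 := by
  have : Fact (Module.finrank ℝ (En 3) = 2 + 1) := ⟨by simp⟩
  apply Submodule.finrank_orthogonal_span_singleton
  rintro rfl
  simp at hv

lemma disc_eq_image (v : En 3) :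
    disc 3 v = (Subtype.val : ((ℝ ∙ v)ᗮ : Submodule ℝ (En 3)) → En 3) '' Metric.ball 0 1 := by
  ext z
  simp only [disc, Set.mem_ofPred_eq, Set.mem_image, mem_ball_zero_iff]
  constructor
  · rintro ⟨h1, h2⟩
    exact ⟨⟨z, Submodule.mem_orthogonal_singleton_iff_inner_right.2 h1⟩, h2, rfl⟩
  · rintro ⟨⟨w, hw⟩, h2, rfl⟩
    exact ⟨Submodule.mem_orthogonal_singleton_iff_inner_right.1 hw, h2⟩

lemma haar_orth (v : En 3) (hv : ‖v‖ = 1) :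
    Measure.IsAddHaarMeasure (μH[2] : Measure ((ℝ ∙ v)ᗮ : Submodule ℝ (En 3))) := by
  have := isAddHaarMeasure_hausdorffMeasure (E := ((ℝ ∙ v)ᗮ : Submodule ℝ (En 3)))
  rw [finrank_orth v hv] at this
  exact_mod_cast this

lemma disc_pos (v : En 3) (hv : ‖v‖ = 1) : μH[2] (disc 3 v) ≠ 0 := by
  rw [disc_eq_image, isometry_subtype_coe.hausdorffMeasure_image (Or.inl (by norm_num))]
  have := haar_orth v hv
  exact (Metric.measure_ball_pos _ _ one_pos).ne'

lemma disc_fin (v : En 3) (hv : ‖v‖ = 1) : μH[2] (disc 3 v) ≠ ∞ := by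
  rw [disc_eq_image, isometry_subtype_coe.hausdorffMeasure_image (Or.inl (by norm_num))]
  have := haar_orth v hv
  exact measure_ball_lt_top.ne

lemma norm_graph (v z : En 3) (hv : ‖v‖ = 1) (hz : ⟪v, z⟫ = 0) (s : ℝ) :
    ‖z + s • v‖ ^ 2 = ‖z‖ ^ 2 + s ^ 2 := by
  rw [norm_add_sq_real, inner_smul_right, real_inner_comm, hz, norm_smul, hv]
  simp

lemma sphere_pos : μH[2] (unitSphere 3) ≠ 0 := by
  let v : En 3 := EuclideanSpace.single 0 1
  have hv : ‖v‖ = 1 := by simp [v]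
  have h := (LipschitzWith.hausdorffMeasure_image_le (K := 1)
    (f := ((ℝ ∙ v)ᗮ : Submodule ℝ (En 3)).starProjection)
    (Submodule.lipschitzWith_starProjection _) (d := 2) (by norm_num) (unitSphere 3))
  intro h0
  rw [h0, mul_zero] at h
  refine disc_pos v hv (le_antisymm (le_trans (measure_mono ?_) h) zero_le)
  rintro z ⟨hz1, hz2⟩
  refine ⟨z + √(1 - ‖z‖ ^ 2) • v, ?_, ?_⟩
  · have h1 := norm_graph v z hv hz1 (√(1 - ‖z‖ ^ 2))
    rw [Real.sq_sqrt (by nlinarith [norm_nonneg z])] at h1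
    rw [unitSphere, mem_sphere_zero_iff_norm]
    nlinarith [norm_nonneg (z + √(1 - ‖z‖ ^ 2) • v)]
  · rw [map_add, map_smul, Submodule.starProjection_eq_self_iff.2
      (Submodule.mem_orthogonal_singleton_iff_inner_right.2 hz1)]
    rw [Submodule.starProjection_orthogonal_apply_eq_zero (Submodule.mem_span_singleton_self v)]
    simp

lemma sphere_fin : μH[2] (unitSphere 3) ≠ ∞ := by
  refine (IsCompact.measure_lt_top_of_nhdsWithin (isCompact_sphere _ _) ?_).ne
  intro v hv
  have hv1 : ‖v‖ = 1 := by simpa using hv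
  have := haar_orth v hv1
  let f : ((ℝ ∙ v)ᗮ : Submodule ℝ (En 3)) → En 3 := fun z => (z : En 3) + √(1 - ‖z‖ ^ 2) • v
  have hf : ContDiffAt ℝ 1 f 0 := by
    apply ContDiffAt.add
    · exact (((ℝ ∙ v)ᗮ : Submodule ℝ (En 3)).subtypeL.contDiff).contDiffAt
    · refine ContDiffAt.fun_smul ?_ contDiffAt_const
      apply ContDiffAt.sqrt
      · exact contDiffAt_const.sub (contDiff_norm_sq ℝ).contDiffAt
      · simp
  obtain ⟨K, t, ht, hK⟩ := hf.exists_lipschitzOnWith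
  let P : En 3 → ((ℝ ∙ v)ᗮ : Submodule ℝ (En 3)) := ((ℝ ∙ v)ᗮ : Submodule ℝ (En 3)).orthogonalProjectionOnto
  have hP : Continuous P := ContinuousLinearMap.continuous _
  have hPv : P v = 0 := by
    apply Submodule.orthogonalProjectionOnto_orthogonal_apply_eq_zero
    exact Submodule.mem_span_singleton_self v
  have ht' : t ∩ Metric.ball 0 1 ∈ 𝓝 (P v) := by
    rw [hPv]; exact Filter.inter_mem ht (Metric.ball_mem_nhds _ one_pos)
  have h1 : P ⁻¹' (t ∩ Metric.ball 0 1) ∈ 𝓝 v := hP.continuousAt ht'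
  have h2 : {x : En 3 | 0 < ⟪v, x⟫} ∈ 𝓝 v := by
    apply IsOpen.mem_nhds
    · exact isOpen_lt continuous_const (by fun_prop)
    · simp [hv1]
  refine ⟨f '' (t ∩ Metric.ball 0 1), ?_, ?_⟩
  · refine Filter.mem_of_superset (Filter.inter_mem (mem_nhdsWithin_of_mem_nhds (Filter.inter_mem h1 h2)) self_mem_nhdsWithin) ?_
    rintro x ⟨⟨hx1, hx2⟩, hx3⟩
    have hx3 : ‖x‖ = 1 := by simpa using hx3
    refine ⟨P x, hx1, ?_⟩
    have e : x = (P x : En 3) + ⟪v, x⟫ • v := by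
      have := Submodule.starProjection_add_starProjection_orthogonal (K := (ℝ ∙ v)) x
      rw [Submodule.starProjection_unit_singleton ℝ hv1] at this
      rw [add_comm]
      exact this.symm
    have e2 := norm_graph v (P x) hv1 (Submodule.mem_orthogonal_singleton_iff_inner_right.1 (P x).2) ⟪v, x⟫
    rw [← e, hx3] at e2
    have e3 : √(1 - ‖P x‖ ^ 2) = ⟪v, x⟫ := by
      have : ‖P x‖ = ‖(P x : En 3)‖ := rfl
      rw [this, show 1 - ‖(P x : En 3)‖ ^ 2 = ⟪v, x⟫ ^ 2 by linarith]
      exact Real.sqrt_sq (le_of_lt hx2)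
    simp only [f, e3]
    exact e.symm
  · refine lt_of_le_of_lt ((hK.mono Set.inter_subset_left).hausdorffMeasure_image_le (by norm_num)) ?_
    refine ENNReal.mul_lt_top (by simp) ?_
    exact lt_of_le_of_lt (measure_mono Set.inter_subset_right) measure_ball_lt_top

instance sigma_prob : IsProbabilityMeasure (sigmaN 3) := ⟨by
  rw [sigmaN, exp_eq]
  simp [ENNReal.inv_mul_cancel sphere_pos sphere_fin]⟩

lemma lambda_prob (v : En 3) (hv : ‖v‖ = 1) : IsProbabilityMeasure (lambdaN 3 v) := ⟨by
  rw [lambdaN, exp_eq]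
  simp [ENNReal.inv_mul_cancel (disc_pos v hv) (disc_fin v hv)]⟩

lemma measurableSet_unitSphere : MeasurableSet (unitSphere 3) := isClosed_sphere.measurableSet

lemma measurableSet_disc (v : En 3) : MeasurableSet (disc 3 v) := by
  have h1 : IsClosed {z : En 3 | ⟪v, z⟫ = 0} := isClosed_eq (by fun_prop) continuous_const
  have h2 : IsOpen {z : En 3 | ‖z‖ < 1} := isOpen_lt (by fun_prop) continuous_const
  exact h1.measurableSet.inter h2.measurableSet

lemma sigma_ae : ∀ᵐ v ∂(sigmaN 3), ‖v‖ = 1 := by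
  rw [sigmaN]
  apply Measure.ae_smul_measure
  filter_upwards [ae_restrict_mem measurableSet_unitSphere] with v hv
  simpa [unitSphere] using hv

lemma lambda_ae (v : En 3) : ∀ᵐ z ∂(lambdaN 3 v), z ∈ disc 3 v := by
  rw [lambdaN]
  apply Measure.ae_smul_measure
  exact ae_restrict_mem (measurableSet_disc v)

lemma hausdorff_mp (h : En 3 ≃ₗᵢ[ℝ] En 3) (d : ℝ) :
    MeasurePreserving h (μH[d] : Measure (En 3)) μH[d] :=
  h.toIsometryEquiv.measurePreserving_hausdorffMeasure d

lemma sigma_mp (h : En 3 ≃ₗᵢ[ℝ] En 3) : MeasurePreserving h (sigmaN 3) (sigmaN 3) := by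
  have := ((hausdorff_mp h (((3 : ℕ) : ℝ) - 1)).restrict_preimage measurableSet_unitSphere).smul_measure
    (μH[((3 : ℕ) : ℝ) - 1] (unitSphere 3))⁻¹
  have e : h ⁻¹' (unitSphere 3) = unitSphere 3 := by
    ext x; simp [unitSphere]
  rw [e] at this
  exact this

lemma lambda_mp (h : En 3 ≃ₗᵢ[ℝ] En 3) (v : En 3) :
    MeasurePreserving h (lambdaN 3 v) (lambdaN 3 (h v)) := by
  have e : h ⁻¹' (disc 3 (h v)) = disc 3 v := by
    ext x; simp [disc]
  have e2 : μH[((3 : ℕ) : ℝ) - 1] (disc 3 (h v)) = μH[((3 : ℕ) : ℝ) - 1] (disc 3 v) := by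
    rw [← e, (hausdorff_mp h _).measure_preimage (measurableSet_disc _).nullMeasurableSet]
  have := ((hausdorff_mp h (((3 : ℕ) : ℝ) - 1)).restrict_preimage (measurableSet_disc (h v))).smul_measure
    (μH[((3 : ℕ) : ℝ) - 1] (disc 3 v))⁻¹
  rw [e] at this
  rw [lambdaN, lambdaN, e2]
  exact this

/-- The base vector. -/
def e0 : En 3 := EuclideanSpace.single 0 1

lemma norm_e0 : ‖e0‖ = 1 := by simp [e0]

/-- Reflection exchanging the base vector and `v`. -/
def refl0 (v : En 3) : En 3 ≃ₗᵢ[ℝ] En 3 := Submodule.reflection (ℝ ∙ (e0 - v))ᗮ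

lemma refl0_e0 (v : En 3) (hv : ‖v‖ = 1) : refl0 v e0 = v :=
  Submodule.reflection_sub (by rw [hv, norm_e0])

lemma refl0_apply (v z : En 3) :
    refl0 v z = z - (2 * (⟪e0 - v, z⟫ / ‖e0 - v‖ ^ 2)) • (e0 - v) := by
  rw [refl0, Submodule.reflection_orthogonal_apply, Submodule.reflection_singleton_apply]
  simp only [RCLike.ofReal_real_eq_id, id]
  module

lemma measurable_refl0 : Measurable (fun p : En 3 × En 3 => refl0 p.1 p.2) := by
  simp_rw [refl0_apply]
  fun_prop

lemma kernel_eq (v : En 3) (hv : ‖v‖ = 1) :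
    (Measure.dirac v).prod (lambdaN 3 v) =
      ((lambdaN 3 e0).map (Prod.mk v)).map (fun p => (p.1, refl0 p.1 p.2)) := by
  have := lambda_prob v hv
  have h := lambda_mp (refl0 v) e0
  rw [refl0_e0 v hv] at h
  rw [Measure.dirac_prod, ← h.map_eq, Measure.map_map (by fun_prop) h.measurable,
    Measure.map_map (measurable_fst.prodMk measurable_refl0) (by fun_prop)]
  rfl

lemma kernel_aemeasurable :
    AEMeasurable (fun v => (Measure.dirac v).prod (lambdaN 3 v)) (sigmaN 3) := by
  have := lambda_prob e0 norm_e0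
  refine ⟨fun v => ((lambdaN 3 e0).map (Prod.mk v)).map (fun p => (p.1, refl0 p.1 p.2)), ?_, ?_⟩
  · exact (Measure.measurable_map _ (measurable_fst.prodMk measurable_refl0)).comp
      Measurable.map_prodMk_left
  · filter_upwards [sigma_ae] with v hv
    exact kernel_eq v hv

lemma kin_lintegral (F : En 3 × En 3 → ℝ≥0∞) (hF : Measurable F) :
    ∫⁻ p, F p ∂(kinematic 3) = ∫⁻ v, ∫⁻ z, F (v, z) ∂(lambdaN 3 v) ∂(sigmaN 3) := by
  rw [kinematic, Measure.lintegral_bind kernel_aemeasurable hF.aemeasurable]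
  apply lintegral_congr_ae
  filter_upwards [sigma_ae] with v hv
  have := lambda_prob v hv
  rw [Measure.dirac_prod, lintegral_map hF (by fun_prop)]

lemma kin_inv (h : En 3 ≃ₗᵢ[ℝ] En 3) (F : En 3 × En 3 → ℝ≥0∞) (hF : Measurable F) :
    ∫⁻ p, F (h p.1, h p.2) ∂(kinematic 3) = ∫⁻ p, F p ∂(kinematic 3) := by
  have hm : Measurable (fun p : En 3 × En 3 => (h p.1, h p.2)) := by
    have := h.continuous
    fun_prop
  have hFm : Measurable (fun p : En 3 × En 3 => F (h p.1, h p.2)) := hF.comp hm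
  rw [kin_lintegral _ hFm, kin_lintegral _ hF,
    ← (sigma_mp h).lintegral_comp_emb h.toHomeomorph.measurableEmbedding
      (fun v => ∫⁻ z, F (v, z) ∂(lambdaN 3 v))]
  apply lintegral_congr
  intro v
  exact (lambda_mp h v).lintegral_comp_emb h.toHomeomorph.measurableEmbedding
    (fun z => F (h v, z))

instance kin_prob : IsProbabilityMeasure (kinematic 3) := ⟨by
  rw [← lintegral_one, kin_lintegral _ measurable_const]
  rw [lintegral_congr_ae (g := fun _ => 1), lintegral_one, measure_univ]
  filter_upwards [sigma_ae] with v hv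
  have := lambda_prob v hv
  simp⟩

/-- Entry and exit points. -/
def XY (p : En 3 × En 3) : En 3 × En 3 := (Xpt 3 p, Ypt 3 p)

lemma measurable_XY : Measurable XY := by
  unfold XY Xpt Ypt
  fun_prop

lemma XY_lin (h : En 3 ≃ₗᵢ[ℝ] En 3) (p : En 3 × En 3) :
    XY (h p.1, h p.2) = (h (XY p).1, h (XY p).2) := by
  simp [XY, Xpt, Ypt]

lemma XY_props (v z : En 3) (hv : ‖v‖ = 1) (hz : z ∈ disc 3 v) :
    ‖(XY (v, z)).1‖ = 1 ∧ ‖(XY (v, z)).2‖ = 1 ∧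
      ⟪(XY (v, z)).1, (XY (v, z)).2⟫ = 2 * ‖z‖ ^ 2 - 1 := by
  obtain ⟨h1, h2⟩ := hz
  have h3 : √(1 - ‖z‖ ^ 2) ^ 2 = 1 - ‖z‖ ^ 2 := Real.sq_sqrt (by nlinarith [norm_nonneg z])
  have hp := norm_graph v z hv h1 (√(1 - ‖z‖ ^ 2))
  have hm := norm_graph v z hv h1 (-√(1 - ‖z‖ ^ 2))
  rw [neg_sq, h3] at hm
  rw [h3] at hp
  rw [neg_smul, ← sub_eq_add_neg] at hm
  refine ⟨?_, ?_, ?_⟩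
  · simp only [XY, Xpt]
    nlinarith [norm_nonneg (z - √(1 - ‖z‖ ^ 2) • v)]
  · simp only [XY, Ypt]
    nlinarith [norm_nonneg (z + √(1 - ‖z‖ ^ 2) • v)]
  · simp only [XY, Xpt, Ypt]
    rw [inner_sub_left, inner_add_right, inner_add_right, real_inner_smul_left, real_inner_smul_left,
      real_inner_smul_right, real_inner_smul_right, h1, real_inner_comm v z, h1, real_inner_self_eq_norm_sq,
      real_inner_self_eq_norm_sq, hv]
    linear_combination -h3

/-- The common law of the inner product. -/
def lawL (v : En 3) : Measure ℝ := (lambdaN 3 v).map (fun z => 2 * ‖z‖ ^ 2 - 1)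

def lawS (y : En 3) : Measure ℝ := (sigmaN 3).map (fun x => ⟪x, y⟫)

lemma main_of_law (hlaw : ∀ v y : En 3, ‖v‖ = 1 → ‖y‖ = 1 → lawL v = lawS y)
    (F : En 3 × En 3 → ℝ≥0∞) (hF : Measurable F) :
    ∫⁻ p, F (XY p) ∂(kinematic 3) = ∫⁻ p, F p ∂((sigmaN 3).prod (sigmaN 3)) := by
  obtain ⟨Φ, hΦ, H⟩ := exists_profile F hF
  have hin : Measurable (fun p : En 3 × En 3 => ⟪p.1, p.2⟫) := by fun_prop
  have hΦi : Measurable (fun p : En 3 × En 3 => Φ ⟪p.1, p.2⟫) := hΦ.comp hin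
  have hΦXY : Measurable (fun p : En 3 × En 3 => Φ ⟪(XY p).1, (XY p).2⟫) := hΦi.comp measurable_XY
  have key1 : ∫⁻ p, F (XY p) ∂(kinematic 3) = ∫⁻ t, Φ t ∂(lawS e0) := by
    have hs : SFinite ((kinematic 3).map XY) := inferInstance
    rw [← lintegral_map hF measurable_XY, H _ hs]
    · rw [lintegral_map hΦi measurable_XY,
        kin_lintegral _ hΦXY]
      rw [lintegral_congr_ae (g := fun _ => ∫⁻ t, Φ t ∂(lawS e0)), lintegral_const, measure_univ,
        mul_one]
      filter_upwards [sigma_ae] with v hv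
      rw [← hlaw v e0 hv norm_e0, lawL, lintegral_map hΦ (by fun_prop)]
      apply lintegral_congr_ae
      filter_upwards [lambda_ae v] with z hz
      rw [(XY_props v z hv hz).2.2]
    · intro h G hG
      have hm : Measurable (fun p : En 3 × En 3 => (h p.1, h p.2)) := by
        have := h.continuous
        fun_prop
      have hGm : Measurable (fun p : En 3 × En 3 => G (h p.1, h p.2)) := hG.comp hm
      rw [lintegral_map hGm measurable_XY, lintegral_map hG measurable_XY,
        ← kin_inv h (fun p => G (XY p)) (hG.comp measurable_XY)]
      simp only [XY_lin]
    · have hms : MeasurableSet {p : En 3 × En 3 | ‖p.1‖ = 1 ∧ ‖p.2‖ = 1} := by measurability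
      rw [ae_map_iff measurable_XY.aemeasurable hms, ae_iff]
      have hms2 : MeasurableSet {p : En 3 × En 3 | ¬ (‖(XY p).1‖ = 1 ∧ ‖(XY p).2‖ = 1)} :=
        (measurable_XY hms).compl
      rw [← lintegral_indicator_one hms2, kin_lintegral _ (measurable_one.indicator hms2)]
      rw [lintegral_congr_ae (g := fun _ => 0), lintegral_zero]
      filter_upwards [sigma_ae] with v hv
      rw [lintegral_congr_ae (g := fun _ => 0), lintegral_zero]
      filter_upwards [lambda_ae v] with z hz
      have := XY_props v z hv hz
      simp [this.1, this.2.1]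
  rw [key1, H _ inferInstance]
  · symm
    rw [lintegral_prod_symm _ hΦi.aemeasurable,
      lintegral_congr_ae (g := fun _ => ∫⁻ t, Φ t ∂(lawS e0)), lintegral_const, measure_univ,
        mul_one]
    filter_upwards [sigma_ae] with y hy
    rw [← hlaw e0 e0 norm_e0 norm_e0, hlaw e0 y norm_e0 hy, lawS, lintegral_map hΦ (by fun_prop)]
  · intro h G hG
    have := (sigma_mp h).prod (sigma_mp h)
    exact this.lintegral_comp hG
  · have hms : MeasurableSet {p : En 3 × En 3 | ‖p.1‖ = 1 ∧ ‖p.2‖ = 1} := by measurability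
    exact (Measure.ae_prod_iff_ae_ae hms).2 (by
      filter_upwards [sigma_ae] with x hx
      filter_upwards [sigma_ae] with y hy
      exact ⟨hx, hy⟩)

open scoped Pointwise in
lemma lawL_Iio (v : En 3) (hv : ‖v‖ = 1) (s : ℝ) :
    lawL v (Set.Iio s) = min 1 (ENNReal.ofReal ((1 + s) / 2)) := by
  have := lambda_prob v hv
  rw [lawL, Measure.map_apply (by fun_prop) measurableSet_Iio]
  by_cases h0 : (1 + s) / 2 ≤ 0
  · rw [ENNReal.ofReal_of_nonpos h0, min_eq_right zero_le]
    convert! measure_empty (μ := lambdaN 3 v)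
    ext z
    simp only [Set.mem_preimage, Set.mem_Iio, Set.mem_empty_iff_false, iff_false, not_lt]
    nlinarith [sq_nonneg ‖z‖]
  push Not at h0
  by_cases h1 : 1 ≤ (1 + s) / 2
  · rw [min_eq_left (by simpa using h1)]
    rw [← measure_univ (μ := lambdaN 3 v)]
    apply measure_congr
    filter_upwards [lambda_ae v] with z hz
    apply propext
    show (2 * ‖z‖ ^ 2 - 1 < s) ↔ True
    simp only [iff_true]
    nlinarith [norm_nonneg z, hz.2]
  push Not at h1
  rw [min_eq_right (by simpa using h1.le)]
  rw [lambdaN, exp_eq, Measure.smul_apply,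
    Measure.restrict_apply (measurableSet_Iio.preimage (by fun_prop))]
  have hr : 0 < √((1 + s) / 2) := Real.sqrt_pos.2 h0
  have hr2 : √((1 + s) / 2) ^ 2 = (1 + s) / 2 := Real.sq_sqrt h0.le
  have e : (fun z : En 3 => 2 * ‖z‖ ^ 2 - 1) ⁻¹' Set.Iio s ∩ disc 3 v = √((1 + s) / 2) • disc 3 v := by
    ext z
    rw [Set.mem_smul_set_iff_inv_smul_mem₀ hr.ne']
    simp only [Set.mem_inter_iff, Set.mem_preimage, Set.mem_Iio, disc, Set.mem_ofPred_eq,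
      inner_smul_right, norm_smul, norm_inv, Real.norm_eq_abs, abs_of_pos hr]
    rw [inv_mul_lt_one₀ hr, mul_eq_zero, or_iff_right (inv_ne_zero hr.ne')]
    constructor
    · rintro ⟨ha, hb, hc⟩
      refine ⟨hb, ?_⟩
      rw [Real.lt_sqrt (norm_nonneg z)]
      linarith
    · rintro ⟨hb, hc⟩
      rw [Real.lt_sqrt (norm_nonneg z)] at hc
      refine ⟨by linarith, hb, ?_⟩
      nlinarith [norm_nonneg z]
  rw [e, Measure.hausdorffMeasure_smul₀ (by norm_num) hr.ne', ENNReal.smul_def, smul_eq_mul, smul_eq_mul,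
    mul_left_comm, ENNReal.inv_mul_cancel (disc_pos v hv) (disc_fin v hv), mul_one]
  rw [ENNReal.ofReal, ENNReal.coe_inj]
  ext
  rw [NNReal.coe_rpow, coe_nnnorm, Real.norm_eq_abs, abs_of_pos hr, Real.coe_toNNReal _ h0.le]
  exact_mod_cast hr2

lemma invariant_unique (τ τ' : Measure (En 3)) [IsProbabilityMeasure τ] [IsProbabilityMeasure τ']
    (h1 : ∀ h : En 3 ≃ₗᵢ[ℝ] En 3, MeasurePreserving h τ τ)
    (h1' : ∀ h : En 3 ≃ₗᵢ[ℝ] En 3, MeasurePreserving h τ' τ')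
    (h2 : ∀ᵐ x ∂τ, ‖x‖ = 1) (h2' : ∀ᵐ x ∂τ', ‖x‖ = 1) : τ = τ' := by
  have hdiag : Measurable (fun x : En 3 => (x, x)) := by fun_prop
  apply Measure.ext
  intro s hs
  have hF : Measurable (fun p : En 3 × En 3 => s.indicator (1 : En 3 → ℝ≥0∞) p.1) :=
    (measurable_one.indicator hs).comp measurable_fst
  obtain ⟨Φ, hΦ, H⟩ := exists_profile _ hF
  have key : ∀ τ : Measure (En 3), IsProbabilityMeasure τ →
      (∀ h : En 3 ≃ₗᵢ[ℝ] En 3, MeasurePreserving h τ τ) → (∀ᵐ x ∂τ, ‖x‖ = 1) → τ s = Φ 1 := by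
    intro τ hτ h1 h2
    have hms : MeasurableSet {p : En 3 × En 3 | ‖p.1‖ = 1 ∧ ‖p.2‖ = 1} := by measurability
    have hin : Measurable (fun p : En 3 × En 3 => ⟪p.1, p.2⟫) := by fun_prop
    have hΦi : Measurable (fun p : En 3 × En 3 => Φ ⟪p.1, p.2⟫) := hΦ.comp hin
    have := H (τ.map (fun x => (x, x))) inferInstance ?_ ?_
    · rw [lintegral_map hF hdiag, lintegral_map hΦi hdiag, lintegral_indicator_one hs] at this
      rw [this, lintegral_congr_ae (g := fun _ => Φ 1), lintegral_const, measure_univ, mul_one]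
      filter_upwards [h2] with x hx
      simp [hx]
    · intro h G hG
      have hm : Measurable (fun p : En 3 × En 3 => (h p.1, h p.2)) := by
        have := h.continuous
        fun_prop
      have hGm : Measurable (fun p : En 3 × En 3 => G (h p.1, h p.2)) := hG.comp hm
      have hGd : Measurable (fun x : En 3 => G (x, x)) := hG.comp hdiag
      rw [lintegral_map hGm hdiag, lintegral_map hG hdiag]
      exact (h1 h).lintegral_comp hGd
    · rw [ae_map_iff hdiag.aemeasurable hms]
      filter_upwards [h2] with x hx
      exact ⟨hx, hx⟩
  rw [key τ inferInstance h1 h2, key τ' inferInstance h1' h2']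

def slice (x : En 3) : ℝ × En 2 := (x 0, WithLp.toLp 2 (fun i : Fin 2 => x i.succ))

lemma slice_mp : MeasurePreserving slice volume (volume.prod volume) := by
  have h1 := PiLp.volume_preserving_ofLp (Fin 3)
  have h2 := volume_preserving_piFinSuccAbove (fun _ : Fin 3 => ℝ) 0
  have h3 := (MeasurePreserving.id (volume : Measure ℝ)).prod (PiLp.volume_preserving_toLp (Fin 2))
  exact h3.comp (h2.comp h1)

lemma slice_norm (x : En 3) : ‖x‖ = √((slice x).1 ^ 2 + ‖(slice x).2‖ ^ 2) := by
  rw [EuclideanSpace.norm_eq, EuclideanSpace.norm_eq, Real.sq_sqrt (by positivity)]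
  simp [slice, Fin.sum_univ_three, Fin.sum_univ_two, add_assoc]

lemma slice_area (s t : ℝ) (hs : 0 < s) (hs1 : s < 1) :
    volume {p : En 2 | √(t ^ 2 + ‖p‖ ^ 2) < 1 ∧ s * √(t ^ 2 + ‖p‖ ^ 2) < t} =
      (Set.Ioc 0 s).indicator (fun t => ENNReal.ofReal (π * (t ^ 2 * (1 / s ^ 2 - 1)))) t +
      (Set.Ioc s 1).indicator (fun t => ENNReal.ofReal (π * (1 - t ^ 2))) t := by
  have hball : ∀ c : ℝ, 0 ≤ c → {p : En 2 | ‖p‖ ^ 2 < c} = Metric.ball 0 √c := by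
    intro c hc
    ext p
    simp [Real.lt_sqrt (norm_nonneg p)]
  have hvol : ∀ c : ℝ, 0 ≤ c → volume {p : En 2 | ‖p‖ ^ 2 < c} = ENNReal.ofReal (π * c) := by
    intro c hc
    rw [hball c hc, EuclideanSpace.volume_ball_fin_two, ← ENNReal.ofReal_pow (Real.sqrt_nonneg c),
      Real.sq_sqrt hc, mul_comm π c, ENNReal.ofReal_mul hc]
  have hcond : ∀ p : En 2, (√(t ^ 2 + ‖p‖ ^ 2) < 1 ∧ s * √(t ^ 2 + ‖p‖ ^ 2) < t) ↔
      (0 < t ∧ ‖p‖ ^ 2 < 1 - t ^ 2 ∧ ‖p‖ ^ 2 < t ^ 2 * (1 / s ^ 2 - 1)) := by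
    intro p
    have e1 : √(t ^ 2 + ‖p‖ ^ 2) < 1 ↔ ‖p‖ ^ 2 < 1 - t ^ 2 := by
      rw [Real.sqrt_lt' one_pos]
      constructor <;> intro h <;> linarith
    have e2 : s * √(t ^ 2 + ‖p‖ ^ 2) < t ↔ 0 < t ∧ ‖p‖ ^ 2 < t ^ 2 * (1 / s ^ 2 - 1) := by
      have hh : t ^ 2 * (1 / s ^ 2 - 1) = t ^ 2 / s ^ 2 - t ^ 2 := by ring
      rw [hh, ← lt_div_iff₀' hs]
      constructor
      · intro h
        have ht : 0 < t / s := lt_of_le_of_lt (Real.sqrt_nonneg _) h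
        rw [Real.sqrt_lt' ht, div_pow] at h
        refine ⟨by rwa [div_pos_iff_of_pos_right hs] at ht, by linarith⟩
      · rintro ⟨ht, h⟩
        rw [Real.sqrt_lt' (div_pos ht hs), div_pow]
        linarith
    rw [e1, e2]
    tauto
  simp_rw [hcond]
  have hs2 : 0 < 1 / s ^ 2 - 1 := by
    rw [sub_pos, lt_div_iff₀ (by positivity)]; nlinarith
  by_cases ht : 0 < t
  swap
  · have a1 : t ∉ Set.Ioc 0 s := fun h => ht h.1
    have a2 : t ∉ Set.Ioc s 1 := fun h => ht (hs.trans h.1)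
    simp [a1, a2, ht]
  by_cases hts : t ≤ s
  · have a1 : t ∈ Set.Ioc 0 s := ⟨ht, hts⟩
    have a2 : t ∉ Set.Ioc s 1 := fun h => absurd h.1 (not_lt.2 hts)
    rw [Set.indicator_of_mem a1, Set.indicator_of_notMem a2, add_zero, ← hvol _ (by positivity)]
    congr 1
    ext p
    simp only [Set.mem_ofPred_eq]
    refine ⟨fun h => h.2.2, fun h => ⟨ht, lt_of_lt_of_le h ?_, h⟩⟩
    have : t ^ 2 * (1 / s ^ 2) ≤ 1 := by
      rw [mul_one_div, div_le_one (by positivity)]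
      nlinarith
    linarith
  push Not at hts
  by_cases ht1 : t ≤ 1
  · have a1 : t ∉ Set.Ioc 0 s := fun h => absurd h.2 (not_le.2 hts)
    have a2 : t ∈ Set.Ioc s 1 := ⟨hts, ht1⟩
    rw [Set.indicator_of_mem a2, Set.indicator_of_notMem a1, zero_add, ← hvol _ (by nlinarith)]
    congr 1
    ext p
    simp only [Set.mem_ofPred_eq]
    refine ⟨fun h => h.2.1, fun h => ⟨ht, h, lt_of_lt_of_le h ?_⟩⟩
    have : 1 ≤ t ^ 2 * (1 / s ^ 2) := by
      rw [mul_one_div, one_le_div (by positivity)]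
      nlinarith
    linarith
  · push Not at ht1
    have a1 : t ∉ Set.Ioc 0 s := fun h => absurd h.2 (not_le.2 hts)
    have a2 : t ∉ Set.Ioc s 1 := fun h => absurd h.2 (not_le.2 ht1)
    rw [Set.indicator_of_notMem a1, Set.indicator_of_notMem a2, add_zero]
    convert! measure_empty (μ := (volume : Measure (En 2)))
    ext p
    simp only [Set.mem_ofPred_eq, Set.mem_empty_iff_false, iff_false]
    rintro ⟨-, h, -⟩
    nlinarith [sq_nonneg ‖p‖]

lemma lint_poly (a b : ℝ) (hab : a ≤ b) (f : ℝ → ℝ) (hf : Continuous f)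
    (h0 : ∀ t ∈ Set.Ioc a b, 0 ≤ f t) :
    ∫⁻ t, (Set.Ioc a b).indicator (fun t => ENNReal.ofReal (f t)) t =
      ENNReal.ofReal (∫ t in a..b, f t) := by
  rw [lintegral_indicator measurableSet_Ioc, intervalIntegral.integral_of_le hab,
    ofReal_integral_eq_lintegral_ofReal]
  · exact (hf.intervalIntegrable a b).1
  · filter_upwards [ae_restrict_mem measurableSet_Ioc] with t ht using h0 t ht

lemma sector_volume (s : ℝ) (hs : 0 < s) (hs1 : s < 1) :
    volume {x : En 3 | ‖x‖ < 1 ∧ s * ‖x‖ < x 0} = ENNReal.ofReal (2 * π / 3 * (1 - s)) := by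
  let T : Set (ℝ × En 2) :=
    {q | √(q.1 ^ 2 + ‖q.2‖ ^ 2) < 1 ∧ s * √(q.1 ^ 2 + ‖q.2‖ ^ 2) < q.1}
  have hT : MeasurableSet T := by
    have h1 : IsOpen {q : ℝ × En 2 | √(q.1 ^ 2 + ‖q.2‖ ^ 2) < 1} :=
      isOpen_lt (by fun_prop) (by fun_prop)
    have h2 : IsOpen {q : ℝ × En 2 | s * √(q.1 ^ 2 + ‖q.2‖ ^ 2) < q.1} :=
      isOpen_lt (by fun_prop) (by fun_prop)
    exact (h1.inter h2).measurableSet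
  have e : {x : En 3 | ‖x‖ < 1 ∧ s * ‖x‖ < x 0} = slice ⁻¹' T := by
    ext x
    simp only [Set.mem_ofPred_eq, Set.mem_preimage, T, ← slice_norm]
    rfl
  rw [e, slice_mp.measure_preimage hT.nullMeasurableSet, Measure.prod_apply hT]
  have e2 : ∀ t : ℝ, volume (Prod.mk t ⁻¹' T) = _ := fun t => slice_area s t hs hs1
  have hs2 : 0 < 1 / s ^ 2 - 1 := by
    rw [sub_pos, lt_div_iff₀ (by positivity)]; nlinarith
  simp_rw [e2]
  rw [lintegral_add_left, lint_poly 0 s hs.le, lint_poly s 1 hs1.le, ← ENNReal.ofReal_add]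
  · congr 1
    simp only [intervalIntegral.integral_const_mul, intervalIntegral.integral_mul_const,
      integral_pow]
    rw [intervalIntegral.integral_sub (by simp) (by simp)]
    simp only [integral_pow, intervalIntegral.integral_const, smul_eq_mul]
    field_simp
    ring
  · apply intervalIntegral.integral_nonneg hs.le
    intro t _
    positivity
  · apply intervalIntegral.integral_nonneg hs1.le
    intro t ht
    have : 0 ≤ 1 - t ^ 2 := by nlinarith [ht.1, ht.2]
    positivity
  · fun_prop
  · intro t ht
    have : 0 ≤ 1 - t ^ 2 := by nlinarith [ht.1, ht.2]
    positivity
  · fun_prop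
  · intro t ht
    positivity
  · exact Measurable.indicator (by fun_prop) measurableSet_Ioc

/-- Cone measure on the sphere. -/
def coneM : Measure (En 3) :=
  ((volume (Metric.ball (0 : En 3) 1))⁻¹ • (volume : Measure (En 3)).restrict (Metric.ball 0 1)).map
    (fun x => ‖x‖⁻¹ • x)

lemma measurable_nrm : Measurable (fun x : En 3 => ‖x‖⁻¹ • x) := by fun_prop

lemma ball_ne_zero : volume (Metric.ball (0 : En 3) 1) ≠ 0 := (Metric.measure_ball_pos _ _ one_pos).ne'

lemma ball_ne_top : volume (Metric.ball (0 : En 3) 1) ≠ ∞ := measure_ball_lt_top.ne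

instance coneM_prob : IsProbabilityMeasure coneM := by
  have : IsProbabilityMeasure ((volume (Metric.ball (0 : En 3) 1))⁻¹ •
      (volume : Measure (En 3)).restrict (Metric.ball 0 1)) := by
    constructor
    rw [Measure.smul_apply, Measure.restrict_apply_univ, smul_eq_mul,
      ENNReal.inv_mul_cancel ball_ne_zero ball_ne_top]
  exact Measure.isProbabilityMeasure_map measurable_nrm.aemeasurable

lemma coneM_mp (h : En 3 ≃ₗᵢ[ℝ] En 3) : MeasurePreserving h coneM coneM := by
  have h1 := (h.measurePreserving.restrict_preimage
    (measurableSet_ball (x := (0 : En 3)) (ε := 1))).smul_measure (volume (Metric.ball (0 : En 3) 1))⁻¹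
  have e : h ⁻¹' (Metric.ball 0 1) = Metric.ball 0 1 := by
    ext x; simp
  rw [e] at h1
  refine ⟨h.continuous.measurable, ?_⟩
  unfold coneM
  rw [Measure.map_map h.continuous.measurable measurable_nrm]
  conv_rhs => rw [← h1.map_eq]
  rw [Measure.map_map measurable_nrm h.continuous.measurable]
  congr 1
  ext1 x
  simp

lemma coneM_ae : ∀ᵐ x ∂coneM, ‖x‖ = 1 := by
  rw [coneM, ae_map_iff measurable_nrm.aemeasurable (by measurability)]
  apply Measure.ae_smul_measure
  apply ae_restrict_of_ae
  filter_upwards [Measure.ae_ne volume (0 : En 3)] with x hx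
  rw [norm_smul, norm_inv, norm_norm, inv_mul_cancel₀ (norm_ne_zero_iff.2 hx)]

lemma sigma_eq_cone : sigmaN 3 = coneM :=
  invariant_unique _ _ sigma_mp coneM_mp sigma_ae coneM_ae

lemma lawS_eq (y : En 3) (hy : ‖y‖ = 1) : lawS y = lawS e0 := by
  have h := sigma_mp (refl0 y)
  have : (fun x : En 3 => ⟪x, e0⟫) = (fun x : En 3 => ⟪x, y⟫) ∘ (refl0 y) := by
    ext x
    simp only [Function.comp]
    rw [← (refl0 y).inner_map_map x e0, refl0_e0 y hy]
  rw [lawS, lawS, this, ← Measure.map_map (by fun_prop) h.measurable, h.map_eq]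

lemma lawS_Ioi (s : ℝ) (hs : 0 < s) (hs1 : s < 1) :
    lawS e0 (Set.Ioi s) = ENNReal.ofReal ((1 - s) / 2) := by
  have hm : Measurable (fun x : En 3 => ⟪x, e0⟫) := by fun_prop
  rw [lawS, Measure.map_apply hm measurableSet_Ioi, sigma_eq_cone, coneM,
    Measure.map_apply measurable_nrm (hm measurableSet_Ioi), Measure.smul_apply,
    Measure.restrict_apply (measurable_nrm (hm measurableSet_Ioi))]
  have e : (fun x : En 3 => ‖x‖⁻¹ • x) ⁻¹' ((fun x : En 3 => ⟪x, e0⟫) ⁻¹' Set.Ioi s) ∩ Metric.ball 0 1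
      = {x : En 3 | ‖x‖ < 1 ∧ s * ‖x‖ < x 0} := by
    ext x
    simp only [Set.mem_inter_iff, Set.mem_preimage, Set.mem_Ioi, mem_ball_zero_iff,
      Set.mem_ofPred_eq, real_inner_smul_left]
    have hx0 : ⟪x, e0⟫ = x 0 := by simp [e0, EuclideanSpace.inner_single_right]
    rw [hx0, and_comm]
    apply and_congr_right
    intro _
    by_cases hx : x = 0
    · subst hx
      simp [hs.le]
    · have := norm_pos_iff.2 hx
      rw [inv_mul_eq_div, lt_div_iff₀ this]
  rw [e, sector_volume s hs hs1, EuclideanSpace.volume_ball_fin_three, smul_eq_mul]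
  rw [ENNReal.ofReal_one, one_pow, one_mul, ← ENNReal.ofReal_inv_of_pos (by positivity),
    ← ENNReal.ofReal_mul (by positivity)]
  congr 1
  have := Real.pi_pos
  field_simp
  ring

lemma lawS_Iio_neg (s : ℝ) :
    lawS e0 (Set.Iio (-s)) = lawS e0 (Set.Ioi s) := by
  have hm : Measurable (fun x : En 3 => ⟪x, e0⟫) := by fun_prop
  have h := sigma_mp (LinearIsometryEquiv.neg ℝ)
  rw [lawS, Measure.map_apply hm measurableSet_Iio, Measure.map_apply hm measurableSet_Ioi,
    ← h.measure_preimage (hm measurableSet_Ioi).nullMeasurableSet]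
  congr 1
  ext x
  simp [lt_neg]

instance lawS_prob : IsProbabilityMeasure (lawS e0) :=
  Measure.isProbabilityMeasure_map (by fun_prop)

lemma lawS_bounds (t : ℝ) (h1 : -1 < t) (h2 : t < 1) (h3 : t ≠ 0) :
    (lawS e0).real (Set.Iio t) ≤ (1 + t) / 2 ∧ (1 + t) / 2 ≤ (lawS e0).real (Set.Iic t) := by
  have hmono : (lawS e0).real (Set.Iio t) ≤ (lawS e0).real (Set.Iic t) :=
    measureReal_mono Set.Iio_subset_Iic_self
  rcases lt_or_gt_of_ne h3 with h | h
  · have e := lawS_Iio_neg (-t)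
    rw [lawS_Ioi (-t) (by linarith) (by linarith), neg_neg] at e
    have e' : (lawS e0).real (Set.Iio t) = (1 + t) / 2 := by
      rw [Measure.real, e, ENNReal.toReal_ofReal (by linarith)]
      ring
    constructor <;> linarith
  · have e := lawS_Ioi t h h2
    have e' : (lawS e0).real (Set.Iic t) = (1 + t) / 2 := by
      rw [← Set.compl_Ioi, probReal_compl_eq_one_sub measurableSet_Ioi, Measure.real, e,
        ENNReal.toReal_ofReal (by linarith)]
      ring
    constructor <;> linarith

lemma exists_between_ne (a b : ℝ) (h : a < b) : ∃ t, a < t ∧ t < b ∧ t ≠ 0 := by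
  by_cases h0 : (a + b) / 2 = 0
  · exact ⟨(a + (a + b) / 2) / 2, by linarith, by linarith, fun h1 => by linarith⟩
  · exact ⟨(a + b) / 2, by linarith, by linarith, h0⟩

lemma lawS_Iio_real (s : ℝ) : (lawS e0).real (Set.Iio s) = min 1 (max 0 ((1 + s) / 2)) := by
  have n0 : 0 ≤ (lawS e0).real (Set.Iio s) := measureReal_nonneg
  have n1 : (lawS e0).real (Set.Iio s) ≤ 1 := measureReal_le_one
  apply le_antisymm
  · by_contra hcon
    push Not at hcon
    have hs1 : s < 1 := by
      by_contra hs
      push Not at hs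
      rw [min_eq_left (le_max_of_le_right (by linarith))] at hcon
      linarith
    rw [min_eq_right (max_le (by norm_num) (by linarith))] at hcon
    have c1 := (le_max_left _ _).trans_lt hcon
    have c2 := (le_max_right _ _).trans_lt hcon
    obtain ⟨t, ht1, ht2, ht3⟩ := exists_between_ne (max s (-1))
      (min 1 (2 * (lawS e0).real (Set.Iio s) - 1))
      (max_lt (lt_min hs1 (by linarith)) (lt_min (by norm_num) (by linarith)))
    rw [max_lt_iff] at ht1
    rw [lt_min_iff] at ht2
    have b := (lawS_bounds t ht1.2 ht2.1 ht3).1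
    have m : (lawS e0).real (Set.Iio s) ≤ (lawS e0).real (Set.Iio t) :=
      measureReal_mono (Set.Iio_subset_Iio ht1.1.le)
    linarith
  · by_contra hcon
    push Not at hcon
    rw [lt_min_iff, lt_max_iff] at hcon
    obtain ⟨c1, c2⟩ := hcon
    have c2 := c2.resolve_left (not_lt.2 n0)
    obtain ⟨t, ht1, ht2, ht3⟩ := exists_between_ne
      (max (-1) (2 * (lawS e0).real (Set.Iio s) - 1)) (min s 1)
      (max_lt (lt_min (by linarith) (by norm_num)) (lt_min (by linarith) (by linarith)))
    rw [max_lt_iff] at ht1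
    rw [lt_min_iff] at ht2
    have b := (lawS_bounds t ht1.1 ht2.2 ht3).2
    have m : (lawS e0).real (Set.Iic t) ≤ (lawS e0).real (Set.Iio s) :=
      measureReal_mono (Set.Iic_subset_Iio.2 ht2.1)
    linarith

lemma law_eq (v y : En 3) (hv : ‖v‖ = 1) (hy : ‖y‖ = 1) : lawL v = lawS y := by
  rw [lawS_eq y hy]
  have := lambda_prob v hv
  have : IsProbabilityMeasure (lawL v) := Measure.isProbabilityMeasure_map (by fun_prop)
  have key : ∀ s, lawL v (Set.Iio s) = lawS e0 (Set.Iio s) := by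
    intro s
    rw [lawL_Iio v hv, ← ENNReal.ofReal_toReal (measure_ne_top (lawS e0) (Set.Iio s))]
    have := lawS_Iio_real s
    rw [Measure.real] at this
    rw [this, ENNReal.ofReal_min, ENNReal.ofReal_one, ENNReal.ofReal_max, ENNReal.ofReal_zero,
      max_eq_right zero_le]
  apply Measure.ext_of_Ici
  intro s
  rw [← Set.compl_Iio, prob_compl_eq_one_sub measurableSet_Iio,
    prob_compl_eq_one_sub measurableSet_Iio, key]

theorem prob_no_point_in_A (A : Set (En 3)) (hA : MeasurableSet A)
    (hAS : A ⊆ unitSphere 3) :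
    kinematic 3 {p : En 3 × En 3 | Xpt 3 p ∉ A ∧ Ypt 3 p ∉ A} = (1 - sigmaN 3 A) ^ 2 := by
  have hm : MeasurableSet (Aᶜ ×ˢ Aᶜ) := hA.compl.prod hA.compl
  have h := main_of_law law_eq ((Aᶜ ×ˢ Aᶜ).indicator 1) (measurable_one.indicator hm)
  rw [lintegral_indicator_one hm, Measure.prod_prod, prob_compl_eq_one_sub hA, ← sq] at h
  rw [← h, ← lintegral_indicator_one]
  · rfl
  · exact measurable_XY hm

end
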